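/- Let k ≥ 1 and let λ be analytic near 0 ∈ ℂ with a zero of order exactly k at 0. (Existence) There exists an analytic map ξ near 0 of the form ξ(δ) = δ·g(δ^{k+1}) with g analytic near 0 and g(0) ≠ 0, such that μ := λ∘ξ has Taylor expansion μ(δ) = (k+1)·δ^k·(1 + higher order terms) in which the coefficient of δ^k equals k+1 and the coefficient of δ^{k+m(k+1)} vanishes for every integer m ≥ 1. (Uniqueness up to rotations of order k) If ξ₁ and ξ₂ are two such maps, then there exists ν ∈ ℂ with ν^k = 1 such that ξ₂(δ) = ξ₁(ν·δ) for all δ in a neighborhood of 0. -/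

import Mathlib

open Metric Set Filter Complex

/-- `μ = λ∘ξ` is in canonical form: the Taylor coefficient of `δ^k` equals `k+1`
(i.e. `μ^{(k)}(0) = (k+1)·k!`) and the coefficient of `δ^{k+m(k+1)}` vanishes for `m ≥ 1`. -/
def CanonicalEigenForm (k : ℕ) (μ : ℂ → ℂ) : Prop :=
  iteratedDeriv k μ 0 = ((k : ℂ) + 1) * (Nat.factorial k : ℂ) ∧
  ∀ m : ℕ, 1 ≤ m → iteratedDeriv (k + m * (k + 1)) μ 0 = 0

open FormalMultilinearSeries (ofScalars)
open scoped Topology ContDiff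

theorem hasFPowerSeriesAt_ofScalars_zero_iff {f : ℂ → ℂ} {c : ℕ → ℂ} :
    HasFPowerSeriesAt f (ofScalars ℂ c) 0 ↔
      ∀ᶠ z in 𝓝 (0 : ℂ), HasSum (fun n => z ^ n * c n) (f z) := by
  simp [hasFPowerSeriesAt_iff']

theorem AnalyticAt.exists_hasSum_zero {f : ℂ → ℂ} (hf : AnalyticAt ℂ f 0) :
    ∃ c : ℕ → ℂ, ∀ᶠ z in 𝓝 (0 : ℂ), HasSum (fun n => z ^ n * c n) (f z) :=
  ⟨_, hasFPowerSeriesAt_ofScalars_zero_iff.1 hf.hasFPowerSeriesAt⟩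

theorem iteratedDeriv_zero_of_hasSum {f : ℂ → ℂ} {c : ℕ → ℂ}
    (h : ∀ᶠ z in 𝓝 (0 : ℂ), HasSum (fun n => z ^ n * c n) (f z)) (n : ℕ) :
    iteratedDeriv n f 0 = n.factorial * c n := by
  have h' := hasFPowerSeriesAt_ofScalars_zero_iff.2 h
  have := h'.eq_formalMultilinearSeries h'.analyticAt.hasFPowerSeriesAt
  have := congrArg (fun p => p.coeff n) this
  simp only [FormalMultilinearSeries.coeff_ofScalars] at this
  have hn : (n.factorial : ℂ) ≠ 0 := by exact_mod_cast n.factorial_ne_zero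
  rw [this]
  field_simp

theorem tendsto_pow_nhds_zero {N : ℕ} (hN : N ≠ 0) :
    Tendsto (fun z : ℂ => z ^ N) (𝓝 0) (𝓝 0) := by
  have : ContinuousAt (fun z : ℂ => z ^ N) 0 := by fun_prop
  simpa [ContinuousAt, hN] using this

/-- A property holding near `0` holds at some `N`-th root of every point near `0`. -/
theorem eventually_exists_pow_eq {N : ℕ} (hN : N ≠ 0) {p : ℂ → Prop}
    (h : ∀ᶠ z in 𝓝 (0 : ℂ), p z) : ∀ᶠ w in 𝓝 (0 : ℂ), ∃ z, z ^ N = w ∧ p z := by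
  obtain ⟨ε, hε, hp⟩ := Metric.eventually_nhds_iff.1 h
  refine Metric.eventually_nhds_iff.2 ⟨ε ^ N, by positivity, fun w hw => ?_⟩
  obtain ⟨z, rfl⟩ := IsAlgClosed.exists_pow_nat_eq w (Nat.pos_of_ne_zero hN)
  refine ⟨z, rfl, hp ?_⟩
  simp only [dist_zero_right, norm_pow] at hw ⊢
  exact lt_of_pow_lt_pow_left₀ N hε.le hw

/-- The decomposition of an analytic germ into its isotypic parts for the rotations of
order `N`. -/
theorem AnalyticAt.exists_residue_decomposition {f : ℂ → ℂ} (hf : AnalyticAt ℂ f 0)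
    {N : ℕ} (hN : N ≠ 0) :
    ∃ S : ℕ → ℂ → ℂ, (∀ r, AnalyticAt ℂ (S r) 0) ∧
      ∀ᶠ z in 𝓝 (0 : ℂ), f z = ∑ r ∈ Finset.range N, z ^ r * S r (z ^ N) := by
  obtain ⟨c, hc⟩ := hf.exists_hasSum_zero
  have : NeZero N := ⟨hN⟩
  have key : ∀ r : ℕ, ∀ᶠ w in 𝓝 (0 : ℂ), Summable fun m => w ^ m * c (r + N * m) := by
    intro r
    filter_upwards [eventually_exists_pow_eq hN hc] with w hw
    obtain ⟨z, rfl, hz⟩ := hw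
    rcases eq_or_ne z 0 with rfl | hz0
    · refine summable_of_ne_finset_zero (s := {0}) fun m hm => ?_
      simp only [Finset.mem_singleton] at hm
      simp [hN, hm]
    · have hinj : Function.Injective fun m : ℕ => r + N * m := fun a b hab => by
        simpa [hN] using hab
      refine ((hz.summable.comp_injective hinj).mul_left (z ^ r)⁻¹).congr fun m => ?_
      simp only [Function.comp, pow_add, pow_mul]
      field_simp
  refine ⟨fun r w => ∑' m, w ^ m * c (r + N * m), fun r => ?_, ?_⟩
  · exact (hasFPowerSeriesAt_ofScalars_zero_iff.2
      ((key r).mono fun w hw => hw.hasSum)).analyticAt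
  · filter_upwards [hc] with z hz
    rw [← hz.tsum_eq, Nat.sumByResidueClasses hz.summable N, ← Fin.sum_univ_eq_sum_range
      (fun r => z ^ r * ∑' m, (z ^ N) ^ m * c (r + N * m))]
    obtain _ | M := N
    · exact absurd rfl hN
    · refine Finset.sum_congr rfl fun j _ => ?_
      rw [← tsum_mul_left]
      refine tsum_congr fun m => ?_
      rw [pow_add, pow_mul, mul_assoc]
      rfl

theorem hasSum_pow_mul_comp_pow {H : ℂ → ℂ} {c : ℕ → ℂ}
    (h : ∀ᶠ z in 𝓝 (0 : ℂ), HasSum (fun n => z ^ n * c n) (H z)) {N : ℕ} (hN : N ≠ 0) (j : ℕ) :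
    ∀ᶠ z in 𝓝 (0 : ℂ), HasSum
      (fun n => z ^ n * Function.extend (fun m => j + m * N) c 0 n) (z ^ j * H (z ^ N)) := by
  have hinj : Function.Injective fun m : ℕ => j + m * N := fun a b hab => by
    simpa [hN] using hab
  filter_upwards [(tendsto_pow_nhds_zero hN).eventually h] with z hz
  rw [← hinj.hasSum_iff]
  · refine (congrArg (HasSum · _) (funext fun m => ?_)).mpr (hz.mul_left (z ^ j))
    rw [Function.comp_apply, hinj.extend_apply]
    ring
  · intro n hn
    rw [Function.extend_apply' _ _ _ (by simpa using hn)]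
    simp

theorem iteratedDeriv_pow_mul_comp_pow {H : ℂ → ℂ} (hH : AnalyticAt ℂ H 0)
    {N : ℕ} (hN : N ≠ 0) (j m : ℕ) :
    iteratedDeriv (j + m * N) (fun z => z ^ j * H (z ^ N)) 0 =
      (j + m * N).factorial * (iteratedDeriv m H 0 / m.factorial) := by
  obtain ⟨c, hc⟩ := hH.exists_hasSum_zero
  have hinj : Function.Injective fun m : ℕ => j + m * N := fun a b hab => by
    simpa [hN] using hab
  rw [iteratedDeriv_zero_of_hasSum (hasSum_pow_mul_comp_pow hc hN j),
    iteratedDeriv_zero_of_hasSum hc, hinj.extend_apply,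
    mul_div_cancel_left₀ _ (by exact_mod_cast m.factorial_ne_zero)]

theorem iteratedDeriv_pow_mul_comp_pow_of_ne {H : ℂ → ℂ} (hH : AnalyticAt ℂ H 0)
    {N : ℕ} (hN : N ≠ 0) {j n : ℕ} (hn : ∀ m, j + m * N ≠ n) :
    iteratedDeriv n (fun z => z ^ j * H (z ^ N)) 0 = 0 := by
  obtain ⟨c, hc⟩ := hH.exists_hasSum_zero
  rw [iteratedDeriv_zero_of_hasSum (hasSum_pow_mul_comp_pow hc hN j),
    Function.extend_apply' _ _ _ (by simpa using hn)]
  simp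

theorem AnalyticAt.eventually_eq_const_iff_iteratedDeriv {H : ℂ → ℂ} (hH : AnalyticAt ℂ H 0)
    (a : ℂ) : (∀ᶠ z in 𝓝 (0 : ℂ), H z = a) ↔
      H 0 = a ∧ ∀ m, 1 ≤ m → iteratedDeriv m H 0 = 0 := by
  constructor
  · intro h
    refine ⟨h.self_of_nhds, fun m hm => ?_⟩
    rw [Filter.EventuallyEq.iteratedDeriv_eq m (g := fun _ => a) h, iteratedDeriv_const,
      if_neg (by omega)]
  · rintro ⟨h0, h⟩
    filter_upwards [hasFPowerSeriesAt_ofScalars_zero_iff.1 hH.hasFPowerSeriesAt] with z hz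
    refine hz.unique ?_
    convert hasSum_single 0 fun n hn => ?_ using 1
    · simp [h0]
    · simp [h n (by omega)]

theorem canonicalEigenForm_iff {k : ℕ} {μ : ℂ → ℂ} {H : ℕ → ℂ → ℂ}
    (hH : ∀ r, AnalyticAt ℂ (H r) 0)
    (hμ : ∀ᶠ z in 𝓝 (0 : ℂ),
      μ z = ∑ r ∈ Finset.range (k + 1), z ^ (k + r) * H r (z ^ (k + 1))) :
    CanonicalEigenForm k μ ↔ ∀ᶠ w in 𝓝 (0 : ℂ), H 0 w = k + 1 := by
  have hderiv (m : ℕ) : iteratedDeriv (k + m * (k + 1)) μ 0 =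
      (k + m * (k + 1)).factorial * (iteratedDeriv m (H 0) 0 / m.factorial) := by
    rw [Filter.EventuallyEq.iteratedDeriv_eq _ hμ, iteratedDeriv_fun_sum,
      Finset.sum_eq_single_of_mem 0 (by simp)]
    · exact iteratedDeriv_pow_mul_comp_pow (hH 0) (Nat.add_one_ne_zero k) k m
    · intro r hr hr0
      refine iteratedDeriv_pow_mul_comp_pow_of_ne (hH r) (Nat.add_one_ne_zero k) fun m' h => hr0 ?_
      have h1 : r + m' * (k + 1) = m * (k + 1) := by omega
      have h2 := congrArg (· % (k + 1)) h1
      simpa [Nat.mod_eq_of_lt (Finset.mem_range.1 hr)] using h2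
    · intro r _
      have : AnalyticAt ℂ (fun z : ℂ => H r (z ^ (k + 1))) 0 :=
        AnalyticAt.fun_comp (by simpa using hH r) (by fun_prop)
      exact ((analyticAt_id.pow (k + r)).mul this).contDiffAt
  have hfac (n : ℕ) : (n.factorial : ℂ) ≠ 0 := by exact_mod_cast n.factorial_ne_zero
  rw [(hH 0).eventually_eq_const_iff_iteratedDeriv, CanonicalEigenForm]
  refine and_congr ?_ (forall₂_congr fun m _ => ?_)
  · have := hderiv 0
    simp only [zero_mul, add_zero, iteratedDeriv_zero, Nat.factorial_zero, Nat.cast_one,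
      div_one] at this
    rw [this, mul_comm, mul_left_inj' (hfac k)]
  · simp [hderiv, hfac]

/-- The symmetric change `δ ↦ δ * g (δ ^ (k + 1))` normalizes the eigenvalue function iff `g`
solves an implicit equation in the parameter `ε = δ ^ (k + 1)`. -/
theorem exists_canonicalEigenForm_iff (k : ℕ) {σ : ℂ → ℂ} (hσ : AnalyticAt ℂ σ 0) :
    ∃ S : ℂ → ℂ, AnalyticAt ℂ S 0 ∧ S 0 = σ 0 ∧ ∀ g : ℂ → ℂ, AnalyticAt ℂ g 0 →
      (CanonicalEigenForm k
        (fun δ : ℂ => (δ * g (δ ^ (k + 1))) ^ k * σ (δ * g (δ ^ (k + 1)))) ↔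
      ∀ᶠ w in 𝓝 (0 : ℂ), g w ^ k * S (w * g w ^ (k + 1)) = k + 1) := by
  obtain ⟨S, hS, hσS⟩ := hσ.exists_residue_decomposition (Nat.add_one_ne_zero k)
  refine ⟨S 0, hS 0, ?_, fun g hg => ?_⟩
  · rw [hσS.self_of_nhds, Finset.sum_eq_single_of_mem 0 (by simp)]
    · simp
    · intro r _ hr
      simp [hr]
  · rw [canonicalEigenForm_iff (H := fun r w => g w ^ (k + r) * S r (w * g w ^ (k + 1)))]
    · simp
    · intro r
      have : AnalyticAt ℂ (fun w => S r (w * g w ^ (k + 1))) 0 :=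
        AnalyticAt.fun_comp (by simpa using hS r) (by fun_prop)
      exact (hg.pow (k + r)).mul this
    · have hg' : AnalyticAt ℂ (fun z : ℂ => g (z ^ (k + 1))) 0 :=
        AnalyticAt.fun_comp (by simpa using hg) (by fun_prop)
      have ht : Tendsto (fun z : ℂ => z * g (z ^ (k + 1))) (𝓝 0) (𝓝 0) := by
        have : ContinuousAt (fun z : ℂ => z * g (z ^ (k + 1))) 0 :=
          continuousAt_id.mul hg'.continuousAt
        simpa [ContinuousAt] using this
      filter_upwards [ht.eventually hσS] with z hz
      rw [hz, Finset.mul_sum]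
      refine Finset.sum_congr rfl fun r _ => ?_
      rw [mul_pow z _ (k + 1)]
      ring

/-- The implicit equation `g ^ k * S (ε * g ^ (k + 1)) = a` has a unique analytic solution
`g = φ ε` near every nondegenerate starting point. -/
theorem exists_implicit_solution {k : ℕ} (hk : 1 ≤ k) {S : ℂ → ℂ} (hS : AnalyticAt ℂ S 0)
    (hS0 : S 0 ≠ 0) {a b : ℂ} (hb : b ≠ 0) (hab : b ^ k * S 0 = a) :
    ∃ φ : ℂ → ℂ, AnalyticAt ℂ φ 0 ∧ φ 0 = b ∧
      ∀ᶠ v in 𝓝 ((0 : ℂ), b), v.2 ^ k * S (v.1 * v.2 ^ (k + 1)) = a ↔ φ v.1 = v.2 := by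
  set f : ℂ × ℂ → ℂ := fun v => v.2 ^ k * S (v.1 * v.2 ^ (k + 1)) with hf
  have hfa : AnalyticAt ℂ f (0, b) := by
    have : AnalyticAt ℂ (fun v : ℂ × ℂ => S (v.1 * v.2 ^ (k + 1))) (0, b) :=
      AnalyticAt.fun_comp (by simpa using hS) (analyticAt_fst.mul (analyticAt_snd.pow (k + 1)))
    exact (analyticAt_snd.pow k).mul this
  have hcd : ContDiffAt ℂ ω f (0, b) := hfa.contDiffAt
  have hline : HasDerivAt (fun y : ℂ => f (0, y)) (k * b ^ (k - 1) * S 0) b := by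
    simpa [hf] using (hasDerivAt_pow k b).mul_const (S 0)
  have hpart : fderiv ℂ f (0, b) ∘L .inr ℂ ℂ ℂ =
      ContinuousLinearMap.toSpanSingleton ℂ (k * b ^ (k - 1) * S 0) := by
    refine HasFDerivAt.unique ?_ hline.hasFDerivAt
    exact hfa.differentiableAt.hasFDerivAt.comp b (hasFDerivAt_prodMk_right 0 b)
  have hne : k * b ^ (k - 1) * S 0 ≠ 0 :=
    mul_ne_zero (mul_ne_zero (by exact_mod_cast (by omega)) (pow_ne_zero _ hb)) hS0
  have hinv : (fderiv ℂ f (0, b) ∘L .inr ℂ ℂ ℂ).IsInvertible := by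
    rw [hpart]
    refine ⟨ContinuousLinearEquiv.unitsEquivAut ℂ (Units.mk0 _ hne), ?_⟩
    ext
    simp
  have hfb : f (0, b) = a := by simpa [hf] using hab
  refine ⟨hcd.implicitFunction (by simp) hinv,
    (hcd.contDiffAt_implicitFunction (by simp) hinv).analyticAt,
    hcd.implicitFunction_apply_self (by simp) hinv, ?_⟩
  simpa only [hfb] using hcd.eventually_apply_eq_iff_implicitFunction (by simp) hinv

/-- Let `λ(δ) = δ^k σ(δ)` have a zero of order exactly `k` at `0`.
(Existence) There is a symmetric change `ξ(δ) = δ·g(δ^{k+1})`, `g(0) ≠ 0`, such that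
`λ∘ξ` is in canonical form. (Uniqueness) Two such changes differ by pre-composition with
multiplication by a `k`-th root of unity: `ξ₂(δ) = ξ₁(ν·δ)` near `0` with `ν^k = 1`. -/
theorem statement10 (k : ℕ) (hk : 1 ≤ k) (σ : ℂ → ℂ)
    (hσ : AnalyticAt ℂ σ 0) (hσ0 : σ 0 ≠ 0) :
    (∃ g : ℂ → ℂ, AnalyticAt ℂ g 0 ∧ g 0 ≠ 0 ∧
      CanonicalEigenForm k
        (fun δ : ℂ => (δ * g (δ ^ (k + 1))) ^ k * σ (δ * g (δ ^ (k + 1))))) ∧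
    (∀ g₁ g₂ : ℂ → ℂ,
      AnalyticAt ℂ g₁ 0 → g₁ 0 ≠ 0 →
      CanonicalEigenForm k
        (fun δ : ℂ => (δ * g₁ (δ ^ (k + 1))) ^ k * σ (δ * g₁ (δ ^ (k + 1)))) →
      AnalyticAt ℂ g₂ 0 → g₂ 0 ≠ 0 →
      CanonicalEigenForm k
        (fun δ : ℂ => (δ * g₂ (δ ^ (k + 1))) ^ k * σ (δ * g₂ (δ ^ (k + 1)))) →
      ∃ ν : ℂ, ν ^ k = 1 ∧ ∀ᶠ δ in nhds (0 : ℂ),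
        δ * g₂ (δ ^ (k + 1)) = (ν * δ) * g₁ ((ν * δ) ^ (k + 1))) := by
  obtain ⟨S, hS, hSσ, hiff⟩ := exists_canonicalEigenForm_iff k hσ
  have hS0 : S 0 ≠ 0 := hSσ ▸ hσ0
  have htend {g : ℂ → ℂ} (hg : AnalyticAt ℂ g 0) :
      Tendsto (fun w => (w, g w)) (𝓝 0) (𝓝 (0, g 0)) :=
    continuousAt_id.prodMk hg.continuousAt
  constructor
  · obtain ⟨b, hb⟩ := IsAlgClosed.exists_pow_nat_eq (((k : ℂ) + 1) / S 0) hk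
    have hb0 : b ≠ 0 := by
      rintro rfl
      rw [zero_pow (by omega)] at hb
      exact div_ne_zero (Nat.cast_add_one_ne_zero k) hS0 hb.symm
    obtain ⟨φ, hφ, rfl, hsol⟩ := exists_implicit_solution hk hS hS0 hb0
      (a := (k : ℂ) + 1) (by rw [hb, div_mul_cancel₀ _ hS0])
    refine ⟨φ, hφ, hb0, (hiff φ hφ).2 ?_⟩
    filter_upwards [(htend hφ).eventually hsol] with w hw
    exact hw.2 rfl
  · intro g₁ g₂ hg₁ hg₁0 hc₁ hg₂ hg₂0 hc₂
    rw [hiff _ hg₁] at hc₁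
    rw [hiff _ hg₂] at hc₂
    have h₁ : g₁ 0 ^ k * S 0 = k + 1 := by simpa using hc₁.self_of_nhds
    have h₂ : g₂ 0 ^ k * S 0 = k + 1 := by simpa using hc₂.self_of_nhds
    obtain ⟨ν, hν⟩ : ∃ ν, ν * g₁ 0 = g₂ 0 := ⟨g₂ 0 / g₁ 0, div_mul_cancel₀ _ hg₁0⟩
    have hνk : ν ^ k = 1 := by
      have := mul_right_cancel₀ hS0 (h₂.trans h₁.symm)
      rw [← hν, mul_pow] at this
      exact mul_eq_right₀ (pow_ne_zero k hg₁0) |>.1 this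
    have hνs : ν ^ (k + 1) = ν := by rw [pow_succ, hνk, one_mul]
    have hνt : Tendsto (fun w : ℂ => ν * w) (𝓝 0) (𝓝 0) := by
      simpa using (continuous_const_mul ν).tendsto 0
    have hg₃ : AnalyticAt ℂ (fun w => ν * g₁ (ν * w)) 0 := by
      have : AnalyticAt ℂ (fun w => g₁ (ν * w)) 0 :=
        AnalyticAt.fun_comp (by simpa using hg₁) (by fun_prop)
      exact analyticAt_const.mul this
    obtain ⟨φ, -, -, hsol⟩ := exists_implicit_solution hk hS hS0 hg₂0 h₂
    have ht₃ := htend hg₃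
    simp only [mul_zero, hν] at ht₃
    have heq : ∀ᶠ w in 𝓝 (0 : ℂ), g₂ w = ν * g₁ (ν * w) := by
      filter_upwards [(htend hg₂).eventually hsol, ht₃.eventually hsol, hc₂,
        hνt.eventually hc₁] with w hw₂ hw₃ hw₂' hw₁
      refine (hw₂.1 hw₂').symm.trans (hw₃.1 ?_)
      rw [mul_pow, mul_pow, hνk, hνs, one_mul, ← hw₁]
      ring_nf
    refine ⟨ν, hνk, ?_⟩
    filter_upwards [(tendsto_pow_nhds_zero (Nat.add_one_ne_zero k)).eventually heq] with δ hδ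
    rw [hδ, mul_pow, hνs]
    ring
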